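/- Let q be a prime power, F the finite field with q elements, n ≥ 2 an integer, and δ ∈ [0,(q-1)/q). The rate R of every linearly recoverable (δ,n)-LRC sequence over F (not necessarily all-disjoint) satisfies the sphere-packing bound R ≤ R̂_SP(δ,n) := R̂_0(δ/2, n). -/

import Mathlib

open Filter Set

noncomputable section

/-- Minimum (Hamming) distance of a code. -/
def minDist {K : Type} [DecidableEq K] {ι : Type} [Fintype ι] (C : Set (ι → K)) : ℕ :=
  sInf {d : ℕ | ∃ c ∈ C, ∃ c' ∈ C, c ≠ c' ∧ hammingDist c c' = d}

/-- `Rg` exhibits `C` as a linearly recoverable LRC with locality `n - 1`. -/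
def IsLinRecLRC {K : Type} [Field K] {N : ℕ} (C : Set (Fin N → K)) (n : ℕ)
    (Rg : Fin N → Finset (Fin N)) : Prop :=
  ∀ j : Fin N, j ∈ Rg j ∧ (Rg j).card ≤ n ∧
    ∃ a : Fin N → K, (∀ i, i ∉ (Rg j).erase j → a i = 0) ∧
      ∀ c ∈ C, c j = ∑ i, a i * c i

/-- `λ_q(ω,n)`. -/
def lambdaQ (q : ℕ) (ω : ℝ) (n : ℕ) : ℝ :=
  ⨅ z : Set.Ioc (0:ℝ) 1,
    (-ω * Real.logb q (z : ℝ) - 1 / n +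
      (1 / n) * Real.logb q ((1 + ((q:ℝ) - 1) * (z:ℝ)) ^ n + ((q:ℝ) - 1) * (1 - (z:ℝ)) ^ n))

/-- `R_0(ω,n) = (n-1)/n - λ_q(ω,n)`. -/
def R0 (q : ℕ) (ω : ℝ) (n : ℕ) : ℝ := ((n:ℝ) - 1) / n - lambdaQ q ω n

/-- The inner minimum `min_ϑ Σ_{s∈[n]} π_s·R_0(ϑ_s,s)` over nonnegative vectors `ϑ`
with `Σ_s π_s·ϑ_s = ω`. -/
def innerMin (q n : ℕ) (ω : ℝ) (π : ℕ → ℝ) : ℝ :=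
  sInf {t : ℝ | ∃ ϑ : ℕ → ℝ, (∀ s ∈ Finset.Icc 1 n, 0 ≤ ϑ s) ∧
    (∑ s ∈ Finset.Icc 1 n, π s * ϑ s) = ω ∧
    t = ∑ s ∈ Finset.Icc 1 n, π s * R0 q (ϑ s) s}

/-- `R̄_0(ω,n,μ)`. -/
def Rbar0 (q n : ℕ) (ω μ : ℝ) : ℝ :=
  sSup {r : ℝ | ∃ π : ℕ → ℝ, (∀ s ∈ Finset.Icc 1 n, 0 ≤ π s) ∧
    (∑ s ∈ Finset.Icc 1 n, π s) = 1 ∧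
    1 / μ ≤ (∑ s ∈ Finset.Icc 1 n, π s / (s : ℝ)) ∧
    r = innerMin q n ω π}

/-- `R̂_0(ω,n) = max_{ν ∈ [0,(n-1)/(n+1)]} [ ν + (1-ν)·R̄_0(ω/(1-ν), n, ((1-ν)/(1+ν))·n) ]`. -/
def Rhat0 (q n : ℕ) (ω : ℝ) : ℝ :=
  sSup {r : ℝ | ∃ ν : ℝ, ν ∈ Set.Icc (0:ℝ) (((n:ℝ) - 1) / ((n:ℝ) + 1)) ∧
    r = ν + (1 - ν) * Rbar0 q n (ω / (1 - ν)) (((1 - ν) / (1 + ν)) * n)}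

open Polynomial in
/-- Weight enumerator of the words of length `s` over a field with `q` elements having a prescribed
value of a full-support linear form; `b = q - 1` for the value zero, `b = -1` otherwise. -/
def cosetEnum (q s : ℕ) (b : ℝ) : Polynomial ℝ :=
  C (q : ℝ)⁻¹ * ((1 + C ((q : ℝ) - 1) * X) ^ s + C b * (1 - X) ^ s)

open Polynomial in
lemma sum_cosetEnum_shift {K : Type} [Field K] [Fintype K] [DecidableEq K]
    (s : ℕ) (a h : K) (hh : h ≠ 0) :
    ∑ x : K, X ^ (if x = 0 then 0 else 1) *
        cosetEnum (Fintype.card K) s (if a - h * x = 0 then (Fintype.card K : ℝ) - 1 else -1)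
      = cosetEnum (Fintype.card K) (s + 1) (if a = 0 then (Fintype.card K : ℝ) - 1 else -1) := by
  set q := Fintype.card K with hq
  have hq0 : (q : ℝ) ≠ 0 := by simp [hq]
  set E : K → Polynomial ℝ := fun b => cosetEnum q s (if b = 0 then (q : ℝ) - 1 else -1) with hE
  have htot : ∑ x : K, E (a - h * x) = (1 + C ((q : ℝ) - 1) * X) ^ s := by
    have hb : Function.Bijective fun x : K => a - h * x := by
      refine Finite.injective_iff_bijective.mp fun x y hxy => ?_
      simpa [hh] using hxy
    rw [hb.sum_comp E]
    have hz : ∑ b : K, C (if b = 0 then (q : ℝ) - 1 else -1) = 0 := by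
      rw [← map_sum, Finset.sum_ite, Finset.sum_const, Finset.sum_const,
        Finset.filter_ne' Finset.univ (0 : K)]
      simp [Finset.filter_eq', Finset.card_erase_of_mem, ← hq]
      rw [hq, Nat.cast_sub (Fintype.card_pos (α := K))]
      simp
    simp only [hE, cosetEnum]
    rw [← Finset.mul_sum, Finset.sum_add_distrib, ← Finset.sum_mul, hz, zero_mul, add_zero,
      Finset.sum_const, Finset.card_univ, ← hq, nsmul_eq_mul, ← mul_assoc, ← C_eq_natCast,
      ← C_mul]
    simp [hq0]
  have hsplit : ∀ x : K, X ^ (if x = 0 then 0 else 1) * E (a - h * x)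
      = X * E (a - h * x) + if x = 0 then (1 - X) * E a else 0 := by
    intro x
    by_cases hx : x = 0
    · simp [hx]; ring
    · simp [hx]
  change ∑ x : K, X ^ (if x = 0 then 0 else 1) * E (a - h * x) = _
  rw [Finset.sum_congr rfl fun x _ => hsplit x, Finset.sum_add_distrib, ← Finset.mul_sum, htot]
  simp only [Finset.sum_ite_eq', Finset.mem_univ, if_true, hE, cosetEnum]
  have hc : C (q : ℝ)⁻¹ * C (q : ℝ) = 1 := by rw [← C_mul]; simp [hq0]
  have hC : C ((q : ℝ) - 1) = C (q : ℝ) - 1 := by simp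
  rw [hC, pow_succ, pow_succ]
  linear_combination (-(X * (1 + (C (q : ℝ) - 1) * X) ^ s)) * hc

open Polynomial in
lemma sum_X_pow_hammingNorm_eq_prod {K Λ : Type} [Field K] [Fintype K] [DecidableEq K]
    [Fintype Λ] [DecidableEq Λ] (M : ℕ) (τ : Fin M → Λ) (g : Fin M → K) (hg : ∀ j, g j ≠ 0)
    (a : Λ → K) :
    ∑ x : Fin M → K, (if ∀ l, ∑ j, (if τ j = l then g j * x j else 0) = a l
        then (X : Polynomial ℝ) ^ (∑ j, if x j = 0 then 0 else 1) else 0)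
      = ∏ l, cosetEnum (Fintype.card K) (∑ j, if τ j = l then 1 else 0)
          (if a l = 0 then (Fintype.card K : ℝ) - 1 else -1) := by
  induction M generalizing a with
  | zero =>
    have hq0 : (Fintype.card K : ℝ) ≠ 0 := by simp
    have h0 : ∀ c : K, cosetEnum (Fintype.card K) 0
        (if c = 0 then (Fintype.card K : ℝ) - 1 else -1) = if c = 0 then 1 else 0 := by
      intro c
      by_cases hc : c = 0
      · simp only [cosetEnum, hc, if_true, pow_zero, mul_one]
        rw [← C_1, ← C_add, ← C_mul]
        simp [hq0]
      · simp [cosetEnum, hc]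
    simp only [Finset.univ_eq_empty, Finset.sum_empty, h0, pow_zero, Finset.sum_const]
    rw [Finset.prod_ite_zero]
    simp [eq_comm]
  | succ M ih =>
    rw [← (Fin.consEquiv fun _ : Fin (M + 1) => K).sum_comp, Fintype.sum_prod_type]
    have key : ∀ x0 : K, ∑ x : Fin M → K,
        (if ∀ l, ∑ j, (if τ j = l then g j * (Fin.consEquiv fun _ : Fin (M + 1) => K) (x0, x) j
            else 0) = a l
          then (X : Polynomial ℝ) ^
            (∑ j, if (Fin.consEquiv fun _ : Fin (M + 1) => K) (x0, x) j = 0 then 0 else 1)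
          else 0)
        = X ^ (if x0 = 0 then 0 else 1) *
          ∏ l, cosetEnum (Fintype.card K) (∑ j : Fin M, if τ j.succ = l then 1 else 0)
            (if (a l - if τ 0 = l then g 0 * x0 else 0) = 0
              then (Fintype.card K : ℝ) - 1 else -1) := by
      intro x0
      rw [← ih (fun j => τ j.succ) (fun j => g j.succ) (fun j => hg _)
        (fun l => a l - if τ 0 = l then g 0 * x0 else 0), Finset.mul_sum]
      refine Finset.sum_congr rfl fun x _ => ?_
      simp only [Fin.consEquiv_apply, Fin.sum_univ_succ, Fin.cons_zero, Fin.cons_succ,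
        eq_sub_iff_add_eq', mul_ite, mul_zero, pow_add]
    rw [Finset.sum_congr rfl fun x0 _ => key x0]
    rw [← Finset.mul_prod_erase _ _ (Finset.mem_univ (τ 0))]
    have herase : ∀ x0 : K, ∏ l, cosetEnum (Fintype.card K)
          (∑ j : Fin M, if τ j.succ = l then 1 else 0)
            (if (a l - if τ 0 = l then g 0 * x0 else 0) = 0
              then (Fintype.card K : ℝ) - 1 else -1)
        = cosetEnum (Fintype.card K) (∑ j : Fin M, if τ j.succ = τ 0 then 1 else 0)
            (if a (τ 0) - g 0 * x0 = 0 then (Fintype.card K : ℝ) - 1 else -1) *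
          ∏ l ∈ Finset.univ.erase (τ 0), cosetEnum (Fintype.card K)
            (∑ j : Fin (M + 1), if τ j = l then 1 else 0)
            (if a l = 0 then (Fintype.card K : ℝ) - 1 else -1) := by
      intro x0
      refine (Finset.mul_prod_erase _ _ (Finset.mem_univ (τ 0))).symm.trans ?_
      refine congrArg₂ (· * ·) ?_ ?_
      · simp
      · refine Finset.prod_congr rfl fun l hl => ?_
        have hl' : τ 0 ≠ l := fun h => (Finset.mem_erase.mp hl).1 h.symm
        rw [Fin.sum_univ_succ, if_neg hl', if_neg hl', zero_add, sub_zero]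
    simp_rw [herase, ← mul_assoc]
    rw [← Finset.sum_mul, sum_cosetEnum_shift _ _ _ (hg 0), Fin.sum_univ_succ]
    simp [add_comm]

open Polynomial in
lemma cosetEnum_zero_left {q : ℕ} (hq : q ≠ 0) : cosetEnum q 0 ((q : ℝ) - 1) = 1 := by
  have hc : C (q : ℝ)⁻¹ * C (q : ℝ) = 1 := by rw [← C_mul]; simp [hq]
  simp only [cosetEnum, pow_zero, mul_one, C_sub, C_1]
  linear_combination hc

open Polynomial in
lemma cosetEnum_one_left {q : ℕ} (hq : q ≠ 0) : cosetEnum q 1 ((q : ℝ) - 1) = 1 := by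
  have hc : C (q : ℝ)⁻¹ * C (q : ℝ) = 1 := by rw [← C_mul]; simp [hq]
  simp only [cosetEnum, pow_one, C_sub, C_1]
  linear_combination hc

lemma exists_minimal_cover {ι : Type} [Fintype ι] [DecidableEq ι] (S : ι → Finset ι)
    (hS : ∀ j, j ∈ S j) :
    ∃ T : Finset ι, (∀ j, ∃ t ∈ T, j ∈ S t) ∧
      ∀ t ∈ T, ∃ p ∈ S t, ∀ t' ∈ T, p ∈ S t' → t' = t := by
  obtain ⟨T, hT⟩ := exists_minimal_of_wellFoundedLT
    (fun T : Finset ι => ∀ j, ∃ t ∈ T, j ∈ S t) ⟨Finset.univ, fun j => ⟨j, by simp, hS j⟩⟩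
  refine ⟨T, hT.prop, fun t ht => ?_⟩
  by_contra! hcon
  have hcov : ∀ j, ∃ t' ∈ T.erase t, j ∈ S t' := by
    intro j
    obtain ⟨t', ht', hj⟩ := hT.prop j
    by_cases h : t' = t
    · subst h
      obtain ⟨t'', h1, h2, h3⟩ := hcon j hj
      exact ⟨t'', Finset.mem_erase.mpr ⟨h3, h1⟩, h2⟩
    · exact ⟨t', Finset.mem_erase.mpr ⟨h, ht'⟩, hj⟩
  exact Finset.notMem_erase t T (hT.le_of_le hcov (Finset.erase_subset t T) ht)

/-- Sphere packing inside the common kernel of the parity checks `h t`, `t ∈ T`, each of which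
owns a private coordinate. -/
lemma ncard_mul_card_mul_pow_le {K : Type} [Field K] [Fintype K] [DecidableEq K] {N d : ℕ}
    (C : Set (Fin N → K)) (hd : ∀ c ∈ C, ∀ c' ∈ C, c ≠ c' → d ≤ hammingDist c c')
    (h : Fin N → Fin N → K) (T : Finset (Fin N))
    (hpriv : ∀ t ∈ T, ∃ p, h t p ≠ 0 ∧ ∀ t' ∈ T, h t' p ≠ 0 → t' = t)
    (hC : ∀ c ∈ C, ∀ t ∈ T, ∑ j, h t j * c j = 0)
    (V : Finset (Fin N → K)) (hV : ∀ v ∈ V, ∀ t ∈ T, ∑ j, h t j * v j = 0)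
    (hVd : ∀ v ∈ V, v = 0 ∨ 2 * hammingNorm v < d) :
    C.ncard * V.card * Fintype.card K ^ T.card ≤ Fintype.card K ^ N := by
  choose! p hp hp' using hpriv
  let Y : (T → K) → Fin N → K := fun y j => ∑ t : T, if p t = j then y t else 0
  have hY : ∀ (y : T → K) (t : T), ∑ j, h t j * Y y j = h t (p t) * y t := by
    intro y t
    simp only [Y, Finset.mul_sum]
    rw [Finset.sum_comm, Finset.sum_eq_single t]
    · simp
    · intro t' _ htt'
      have h0 : h t (p t') = 0 := by
        by_contra h0
        exact htt' (Subtype.ext (hp' t' t'.2 t t.2 h0).symm)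
      simp [h0]
    · simp
  let Φ : C × V × (T → K) → (Fin N → K) := fun w => w.1.1 + w.2.1.1 + Y w.2.2
  have hΦ : Function.Injective Φ := by
    rintro ⟨⟨c, hc⟩, ⟨v, hv⟩, y⟩ ⟨⟨c', hc'⟩, ⟨v', hv'⟩, y'⟩ heq
    have heq' : c + v + Y y = c' + v' + Y y' := heq
    have hyy : y = y' := by
      funext t
      have h1 : ∑ j, h t j * (c + v + Y y) j = ∑ j, h t j * (c' + v' + Y y') j := by rw [heq']
      simp only [Pi.add_apply, mul_add, Finset.sum_add_distrib, hY, hC c hc t t.2,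
        hC c' hc' t t.2, hV v hv t t.2, hV v' hv' t t.2, zero_add] at h1
      exact mul_left_cancel₀ (hp t t.2) h1
    subst hyy
    have hcv : c + v = c' + v' := add_right_cancel heq'
    have hcc : c = c' := by
      by_contra hne
      have h1 := hd c hc c' hc' hne
      have hsub : -c + c' = -v' + v := by linear_combination -hcv
      have h2 : hammingDist c c' ≤ hammingNorm v' + hammingNorm v := by
        rw [hammingDist_eq_hammingNorm, hsub, ← hammingDist_eq_hammingNorm,
          ← hammingDist_zero_right v', ← congrFun hammingDist_zero_left v]
        exact hammingDist_triangle v' 0 v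
      have h3 : 0 < hammingDist c c' := hammingDist_pos.mpr hne
      have h4 : hammingNorm v = 0 ∨ 2 * hammingNorm v < d :=
        (hVd v hv).imp_left hammingNorm_eq_zero.mpr
      have h5 : hammingNorm v' = 0 ∨ 2 * hammingNorm v' < d :=
        (hVd v' hv').imp_left hammingNorm_eq_zero.mpr
      omega
    subst hcc
    have hvv : v = v' := add_left_cancel hcv
    subst hvv
    rfl
  have hcard := Nat.card_le_card_of_injective Φ hΦ
  rw [Nat.card_prod, Nat.card_prod, Nat.card_coe_set_eq] at hcard
  simpa [mul_assoc] using hcard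

open Polynomial in
/-- Reduction of a linearly recoverable code to disjoint repair groups: `k s` counts the groups of
size `s`, and `D` the coordinates lying in several groups of a minimal cover. -/
lemma exists_disjoint_groups {K : Type} [Field K] [Fintype K] [DecidableEq K] {N n : ℕ}
    (C : Set (Fin N → K)) (hC : ∃ Rg, IsLinRecLRC C n Rg) :
    ∃ (k : ℕ → ℕ) (D : ℕ) (A : Finset (Fin N → K)),
      ∑ s ∈ Finset.Icc 1 n, k s * s + D = N ∧
      N + D ≤ n * ∑ s ∈ Finset.Icc 1 n, k s ∧
      ∑ x ∈ A, (X : Polynomial ℝ) ^ hammingNorm x = ∏ s ∈ Finset.Icc 1 n,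
        cosetEnum (Fintype.card K) s ((Fintype.card K : ℝ) - 1) ^ k s ∧
      (0 : Fin N → K) ∈ A ∧
      C.ncard * (A.filter fun x => x = 0 ∨ 2 * hammingNorm x < minDist C).card *
        Fintype.card K ^ (∑ s ∈ Finset.Icc 1 n, k s) ≤ Fintype.card K ^ N := by
  obtain ⟨Rg, hRg⟩ := hC
  choose hmem hcard a ha hrec using hRg
  let h : Fin N → Fin N → K := fun t j => (if j = t then 1 else 0) - a t j
  let S : Fin N → Finset (Fin N) := fun t => Finset.univ.filter fun j => h t j ≠ 0
  have hS : ∀ t j, j ∈ S t ↔ h t j ≠ 0 := by intro t j; simp [S]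
  have hSself : ∀ t, t ∈ S t := by
    intro t
    simp [hS, h, ha t t (by simp)]
  have hScard : ∀ t, (S t).card ≤ n := by
    intro t
    refine (Finset.card_le_card fun j hj => ?_).trans (hcard t)
    by_contra hj'
    have hjt : j ≠ t := fun e => hj' (e ▸ hmem t)
    exact (hS t j).mp hj (by simp [h, hjt, ha t j (fun e => hj' (Finset.mem_of_mem_erase e))])
  have hChk : ∀ c ∈ C, ∀ t, ∑ j, h t j * c j = 0 := by
    intro c hc t
    simp [h, sub_mul, Finset.sum_sub_distrib, ← hrec t c hc]
  obtain ⟨T, hcov, hpriv⟩ := exists_minimal_cover S hSself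
  choose f hfT hfS using hcov
  classical
  let u : Fin N → Prop := fun j => ∀ t ∈ T, j ∈ S t → t = f j
  let τ : Fin N → Fin N ⊕ Fin N := fun j => if u j then Sum.inl (f j) else Sum.inr j
  let g : Fin N → K := fun j => if u j then h (f j) j else 1
  have hg : ∀ j, g j ≠ 0 := by
    intro j
    by_cases hj : u j
    · simpa [g, hj] using (hS _ _).mp (hfS j)
    · simp [g, hj]
  have hτl : ∀ j t, τ j = Sum.inl t ↔ u j ∧ f j = t := by
    intro j t
    by_cases hj : u j <;> simp [τ, hj]
  have hτr : ∀ j i, τ j = Sum.inr i ↔ ¬ u j ∧ j = i := by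
    intro j i
    by_cases hj : u j <;> simp [τ, hj]
  let A : Finset (Fin N → K) :=
    Finset.univ.filter fun x => ∀ l, ∑ j, (if τ j = l then g j * x j else 0) = 0
  have hA : ∀ x ∈ A, ∀ t ∈ T, ∑ j, h t j * x j = 0 := by
    intro x hx t ht
    have hx' : ∀ l, ∑ j, (if τ j = l then g j * x j else 0) = 0 := by simpa [A] using hx
    rw [← hx' (Sum.inl t)]
    refine Finset.sum_congr rfl fun j _ => ?_
    simp only [hτl]
    by_cases hj : u j
    · by_cases hft : f j = t
      · simp [hj, hft, g]
      · have : h t j = 0 := by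
          by_contra h0
          exact hft (hj t ht ((hS t j).mpr h0)).symm
        simp [hft, this]
    · have hxj : x j = 0 := by
        have := hx' (Sum.inr j)
        rw [Finset.sum_eq_single j] at this
        · simpa [hτr, hj, g] using this
        · intro i _ hij
          simp [hτr, hij]
        · simp
      simp [hj, hxj]
  let c : Fin N → ℕ := fun t => ∑ j, if τ j = Sum.inl t then 1 else 0
  have hc : ∀ t, c t = (Finset.univ.filter fun j => u j ∧ f j = t).card := by
    intro t
    simp only [c, hτl, Finset.card_filter]
  have hcmem : ∀ t ∈ T, c t ∈ Finset.Icc 1 n := by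
    intro t ht
    rw [Finset.mem_Icc, hc]
    constructor
    · obtain ⟨p, hp, hp'⟩ := hpriv t ht
      have hfp : f p = t := hp' _ (hfT p) (hfS p)
      exact Finset.card_pos.mpr ⟨p, Finset.mem_filter.mpr
        ⟨Finset.mem_univ p, fun t' ht' h' => hfp ▸ hp' t' ht' h', hfp⟩⟩
    · refine (Finset.card_le_card fun j hj => ?_).trans (hScard t)
      have hj' : u j ∧ f j = t := by simpa using hj
      exact hj'.2 ▸ hfS j
  let k : ℕ → ℕ := fun s => (T.filter fun t => c t = s).card
  have hksum : ∑ s ∈ Finset.Icc 1 n, k s = T.card :=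
    (Finset.card_eq_sum_card_fiberwise hcmem).symm
  refine ⟨k, (Finset.univ.filter fun j => ¬ u j).card, A, ?_, ?_, ?_, by simp [A], ?_⟩
  · have h1 : ∑ s ∈ Finset.Icc 1 n, k s * s = ∑ t ∈ T, c t := by
      rw [← Finset.sum_fiberwise_of_maps_to hcmem]
      refine Finset.sum_congr rfl fun s _ => ?_
      rw [Finset.sum_congr rfl fun t ht => (Finset.mem_filter.mp ht).2]
      simp [k]
    have h2 : (Finset.univ.filter u).card = ∑ t ∈ T, c t := by
      rw [Finset.card_eq_sum_card_fiberwise (f := f) (t := T) fun j _ => hfT j]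
      refine Finset.sum_congr rfl fun t _ => ?_
      rw [hc, Finset.filter_filter]
    rw [h1, ← h2, Finset.card_filter_add_card_filter_not]
    simp
  · have h1 : ∑ t ∈ T, (S t).card ≤ n * T.card := by
      rw [mul_comm, ← smul_eq_mul]
      exact Finset.sum_le_card_nsmul _ _ _ fun t _ => hScard t
    have h2 : ∑ t ∈ T, (S t).card = ∑ j, (T.filter fun t => j ∈ S t).card := by
      have := Finset.sum_card_bipartiteAbove_eq_sum_card_bipartiteBelow
        (s := T) (t := Finset.univ) fun t j => j ∈ S t
      simpa [Finset.bipartiteAbove, Finset.bipartiteBelow] using this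
    have h3 : ∀ j, 1 + (if ¬ u j then 1 else 0) ≤ (T.filter fun t => j ∈ S t).card := by
      intro j
      have hfj : f j ∈ T.filter fun t => j ∈ S t := by simp [hfT, hfS]
      by_cases hj : u j
      · rw [if_neg (not_not_intro hj)]
        exact Finset.card_pos.mpr ⟨f j, hfj⟩
      · have hj' := hj
        simp only [u, not_forall] at hj'
        obtain ⟨t, ht, hjt, hne⟩ := hj'
        have : 1 < (T.filter fun t => j ∈ S t).card :=
          Finset.one_lt_card.mpr ⟨t, by simp [ht, hjt], f j, hfj, hne⟩
        simp only [hj, not_false_eq_true, if_true]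
        omega
    calc N + (Finset.univ.filter fun j => ¬ u j).card
        = ∑ j : Fin N, (1 + (if ¬ u j then 1 else 0)) := by
          rw [Finset.sum_add_distrib, Finset.card_filter]; simp
      _ ≤ ∑ j, (T.filter fun t => j ∈ S t).card := Finset.sum_le_sum fun j _ => h3 j
      _ ≤ n * ∑ s ∈ Finset.Icc 1 n, k s := by rw [← h2, hksum]; exact h1
  · have hq : Fintype.card K ≠ 0 := Fintype.card_ne_zero
    have h1 := sum_X_pow_hammingNorm_eq_prod N τ g hg 0
    simp only [Pi.zero_apply, if_true] at h1
    have h2 : ∀ x : Fin N → K, hammingNorm x = ∑ j, if x j = 0 then 0 else 1 := by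
      intro x
      simp only [hammingNorm, Finset.card_filter, ne_eq, ite_not]
    simp only [A, Finset.sum_filter, h2]
    rw [h1, Fintype.prod_sum_type]
    have hinr : ∏ i : Fin N, cosetEnum (Fintype.card K) (∑ j, if τ j = Sum.inr i then 1 else 0)
        ((Fintype.card K : ℝ) - 1) = 1 := by
      refine Finset.prod_eq_one fun i _ => ?_
      rw [Finset.sum_eq_single i]
      · by_cases hi : τ i = Sum.inr i
        · rw [if_pos hi, cosetEnum_one_left hq]
        · rw [if_neg hi, cosetEnum_zero_left hq]
      · intro j _ hij
        simp [hτr, hij]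
      · simp
    rw [hinr, mul_one]
    change ∏ t, cosetEnum (Fintype.card K) (c t) ((Fintype.card K : ℝ) - 1) = _
    rw [← Finset.prod_subset (Finset.subset_univ T), ← Finset.prod_fiberwise_of_maps_to hcmem]
    · refine Finset.prod_congr rfl fun s _ => ?_
      rw [Finset.prod_congr rfl fun t ht => by rw [(Finset.mem_filter.mp ht).2]]
      simp [k]
    · intro t _ ht
      have : c t = 0 := by
        refine Finset.sum_eq_zero fun j _ => ?_
        rw [if_neg]
        rw [hτl]
        exact fun e => ht (e.2 ▸ hfT j)
      rw [this, cosetEnum_zero_left hq]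
  · rw [hksum]
    refine ncard_mul_card_mul_pow_le C (d := minDist C) (fun x hx y hy hne =>
      Nat.sInf_le ⟨x, hx, y, hy, hne, rfl⟩) h T ?_ (fun x hx t _ => hChk x hx t) _
      (fun v hv => hA v (Finset.mem_filter.mp hv).1) (fun v hv => (Finset.mem_filter.mp hv).2)
    intro t ht
    obtain ⟨p, hp, hp'⟩ := hpriv t ht
    exact ⟨p, (hS t p).mp hp, fun t' ht' h' => hp' t' ht' ((hS t' p).mpr h')⟩

lemma eval_cosetEnum (q s : ℕ) (b z : ℝ) :
    (cosetEnum q s b).eval z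
      = (q : ℝ)⁻¹ * ((1 + ((q : ℝ) - 1) * z) ^ s + b * (1 - z) ^ s) := by
  simp [cosetEnum]

lemma one_le_eval_cosetEnum {q : ℕ} (hq : 1 ≤ q) (s : ℕ) {z : ℝ} (hz : z ∈ Set.Icc (0 : ℝ) 1) :
    1 ≤ (cosetEnum q s ((q : ℝ) - 1)).eval z := by
  have hq1 : (1 : ℝ) ≤ q := by exact_mod_cast hq
  have h1 : 1 + s * (((q : ℝ) - 1) * z) ≤ (1 + ((q : ℝ) - 1) * z) ^ s :=
    one_add_mul_le_pow (by nlinarith [hz.1]) s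
  have h2 : 1 + s * (-z) ≤ (1 + -z) ^ s := one_add_mul_le_pow (by linarith [hz.2]) s
  rw [eval_cosetEnum, inv_mul_eq_div, le_div_iff₀ (by linarith), one_mul, sub_eq_add_neg 1 z]
  nlinarith [mul_le_mul_of_nonneg_left h2 (sub_nonneg.mpr hq1)]

section Moments

open Polynomial

/-- The Euler operator `z · d/dz` on polynomials. -/
def eulerOp (P : Polynomial ℝ) : Polynomial ℝ := X * derivative P

/-- For a weight enumerator `P`, bounds on the mean (divided by `z`) and on the variance of the
weight distribution proportional to `P_w z ^ w`. -/
def MomentBound (z v : ℝ) (P : Polynomial ℝ) : Prop :=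
  0 < P.eval z ∧ (derivative P).eval z ≤ v * P.eval z ∧
    (eulerOp (eulerOp P)).eval z * P.eval z - (eulerOp P).eval z ^ 2 ≤ v * P.eval z ^ 2

lemma MomentBound.one (z : ℝ) : MomentBound z 0 1 := by
  simp [MomentBound, eulerOp]

lemma MomentBound.mul {z v w : ℝ} {P Q : Polynomial ℝ} (hP : MomentBound z v P)
    (hQ : MomentBound z w Q) : MomentBound z (v + w) (P * Q) := by
  obtain ⟨hP0, hP1, hP2⟩ := hP
  obtain ⟨hQ0, hQ1, hQ2⟩ := hQ
  refine ⟨by rw [eval_mul]; positivity, ?_, ?_⟩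
  · simp only [derivative_mul, eval_add, eval_mul]
    nlinarith [mul_le_mul_of_nonneg_right hP1 hQ0.le, mul_le_mul_of_nonneg_right hQ1 hP0.le]
  · have h1 := mul_le_mul_of_nonneg_right hP2 (sq_nonneg (Q.eval z))
    have h2 := mul_le_mul_of_nonneg_right hQ2 (sq_nonneg (P.eval z))
    simp only [eulerOp, derivative_mul, derivative_X, eval_add, eval_mul, eval_X, one_mul,
      derivative_add] at h1 h2 ⊢
    linarith

lemma MomentBound.pow {z v : ℝ} {P : Polynomial ℝ} (hP : MomentBound z v P) (k : ℕ) :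
    MomentBound z (k * v) (P ^ k) := by
  induction k with
  | zero => simpa using MomentBound.one z
  | succ k ih =>
    rw [pow_succ]
    convert ih.mul hP using 1
    push_cast
    ring

lemma MomentBound.prod {ι : Type} {z : ℝ} (I : Finset ι) (v : ι → ℝ) (P : ι → Polynomial ℝ)
    (h : ∀ i ∈ I, MomentBound z (v i) (P i)) :
    MomentBound z (∑ i ∈ I, v i) (∏ i ∈ I, P i) := by
  classical
  induction I using Finset.induction_on with
  | empty => simpa using MomentBound.one z
  | insert i I hi ih =>
    rw [Finset.sum_insert hi, Finset.prod_insert hi]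
    exact (h i (Finset.mem_insert_self i I)).mul
      (ih fun j hj => h j (Finset.mem_insert_of_mem hj))

lemma exists_eval_le_of_mem_Icc (P : Polynomial ℝ) :
    ∃ c : ℝ, ∀ z ∈ Set.Icc (0 : ℝ) 1, P.eval z ≤ c := by
  obtain ⟨c, hc⟩ := isCompact_Icc.exists_bound_of_continuousOn (s := Set.Icc (0 : ℝ) 1)
    P.continuous.continuousOn
  exact ⟨c, fun z hz => (le_abs_self _).trans (hc z hz)⟩

lemma exists_momentBound_cosetEnum {q : ℕ} (hq : 1 ≤ q) (n : ℕ) :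
    ∃ c : ℝ, 1 ≤ c ∧ ∀ s ∈ Finset.Icc 1 n, ∀ z ∈ Set.Icc (0 : ℝ) 1,
      MomentBound z c (cosetEnum q s ((q : ℝ) - 1)) ∧
      (cosetEnum q s ((q : ℝ) - 1)).eval z ≤ 1 + c * z := by
  set B : ℕ → Polynomial ℝ := fun s => cosetEnum q s ((q : ℝ) - 1) with hB
  choose c₁ hc₁ using fun s => exists_eval_le_of_mem_Icc (derivative (B s))
  choose c₂ hc₂ using fun s => exists_eval_le_of_mem_Icc (eulerOp (eulerOp (B s)))
  choose c₃ hc₃ using fun s => exists_eval_le_of_mem_Icc (divX (B s))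
  set c : ℝ := 1 + ∑ s ∈ Finset.Icc 1 n, (|c₁ s| + |c₂ s| + |c₃ s|) with hc
  have hle : ∀ s ∈ Finset.Icc 1 n, |c₁ s| + |c₂ s| + |c₃ s| ≤ c - 1 := by
    intro s hs
    rw [hc, add_sub_cancel_left]
    exact Finset.single_le_sum (f := fun s => |c₁ s| + |c₂ s| + |c₃ s|)
      (fun s _ => by positivity) hs
  have hc1 : 1 ≤ c := by
    rw [hc]
    have : 0 ≤ ∑ s ∈ Finset.Icc 1 n, (|c₁ s| + |c₂ s| + |c₃ s|) :=
      Finset.sum_nonneg fun s _ => by positivity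
    linarith
  refine ⟨c, hc1, fun s hs z hz => ?_⟩
  have hs' := hle s hs
  have hB1 : 1 ≤ (B s).eval z := one_le_eval_cosetEnum hq s hz
  have h1 : (derivative (B s)).eval z ≤ c := by
    linarith [hc₁ s z hz, le_abs_self (c₁ s), abs_nonneg (c₂ s), abs_nonneg (c₃ s)]
  have h2 : (eulerOp (eulerOp (B s))).eval z ≤ c := by
    linarith [hc₂ s z hz, le_abs_self (c₂ s), abs_nonneg (c₁ s), abs_nonneg (c₃ s)]
  have h3 : (divX (B s)).eval z ≤ c := by
    linarith [hc₃ s z hz, le_abs_self (c₃ s), abs_nonneg (c₁ s), abs_nonneg (c₂ s)]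
  refine ⟨⟨by linarith, by nlinarith, ?_⟩, ?_⟩
  · have h4 : (eulerOp (eulerOp (B s))).eval z * (B s).eval z ≤ c * (B s).eval z :=
      mul_le_mul_of_nonneg_right h2 (by linarith)
    have h5 : c * (B s).eval z ≤ c * (B s).eval z ^ 2 :=
      mul_le_mul_of_nonneg_left (by nlinarith) (by linarith)
    linarith [sq_nonneg ((eulerOp (B s)).eval z)]
  · have h0 : (B s).coeff 0 = 1 := by
      have : (q : ℝ) ≠ 0 := by positivity
      rw [coeff_zero_eq_eval_zero, hB, eval_cosetEnum]
      simp [this]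
    have h4 := congrArg (eval z) (divX_mul_X_add (B s))
    simp only [eval_add, eval_mul, eval_X, eval_C, h0] at h4
    have := mul_le_mul_of_nonneg_right h3 hz.1
    change (B s).eval z ≤ _
    linarith

variable {α : Type}

lemma eval_sum_X_pow (A : Finset α) (wt : α → ℕ) (z : ℝ) :
    (∑ x ∈ A, (X : Polynomial ℝ) ^ wt x).eval z = ∑ x ∈ A, z ^ wt x := by
  simp [eval_finsetSum]

lemma eulerOp_sum_C_mul_X_pow (A : Finset α) (wt : α → ℕ) (b : α → ℝ) :
    eulerOp (∑ x ∈ A, C (b x) * X ^ wt x) = ∑ x ∈ A, C (wt x * b x) * X ^ wt x := by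
  simp only [eulerOp, derivative_sum, Finset.mul_sum]
  refine Finset.sum_congr rfl fun x _ => ?_
  rcases Nat.eq_zero_or_pos (wt x) with h | h
  · simp [h]
  · obtain ⟨m, hm⟩ := Nat.exists_eq_succ_of_ne_zero h.ne'
    simp only [hm, derivative_C_mul, derivative_X_pow, Nat.succ_eq_add_one, Nat.add_sub_cancel,
      C_mul]
    ring

/-- Chebyshev's inequality for the weight distribution proportional to `z ^ wt x`. -/
lemma half_eval_le_sum_filter (A : Finset α) (wt : α → ℕ) {z v r μ : ℝ} (hz : 0 ≤ z)
    (hr : 0 < r) (hvr : 2 * v ≤ r ^ 2)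
    (hM : MomentBound z v (∑ x ∈ A, (X : Polynomial ℝ) ^ wt x))
    (hμ : (eulerOp (∑ x ∈ A, (X : Polynomial ℝ) ^ wt x)).eval z
      = μ * ∑ x ∈ A, z ^ wt x) :
    (∑ x ∈ A, z ^ wt x) / 2 ≤ ∑ x ∈ A.filter (fun x => |(wt x : ℝ) - μ| ≤ r), z ^ wt x := by
  obtain ⟨hW, -, hvar⟩ := hM
  have e0 : ∑ x ∈ A, (X : Polynomial ℝ) ^ wt x = ∑ x ∈ A, C 1 * X ^ wt x := by simp
  have e1 : eulerOp (∑ x ∈ A, (X : Polynomial ℝ) ^ wt x)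
      = ∑ x ∈ A, C (wt x : ℝ) * X ^ wt x := by
    rw [e0, eulerOp_sum_C_mul_X_pow]; simp
  have e2 : (eulerOp (eulerOp (∑ x ∈ A, (X : Polynomial ℝ) ^ wt x))).eval z
      = ∑ x ∈ A, (wt x : ℝ) ^ 2 * z ^ wt x := by
    rw [e1, eulerOp_sum_C_mul_X_pow]; simp [eval_finsetSum, sq]
  rw [eval_sum_X_pow] at hW
  rw [hμ, e2, eval_sum_X_pow] at hvar
  rw [e1] at hμ
  simp only [eval_finsetSum, eval_mul, eval_C, eval_pow, eval_X] at hμ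
  set W := ∑ x ∈ A, z ^ wt x with hWdef
  have hvar' : ∑ x ∈ A, (wt x : ℝ) ^ 2 * z ^ wt x - μ ^ 2 * W ≤ v * W := by
    refine le_of_mul_le_mul_right ?_ hW
    linarith
  have hsq : ∑ x ∈ A, ((wt x : ℝ) - μ) ^ 2 * z ^ wt x
      = ∑ x ∈ A, (wt x : ℝ) ^ 2 * z ^ wt x - μ ^ 2 * W := by
    have : ∀ x ∈ A, ((wt x : ℝ) - μ) ^ 2 * z ^ wt x
        = (wt x : ℝ) ^ 2 * z ^ wt x - 2 * μ * (wt x * z ^ wt x) + μ ^ 2 * z ^ wt x :=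
      fun x _ => by ring
    rw [Finset.sum_congr rfl this, Finset.sum_add_distrib, Finset.sum_sub_distrib,
      ← Finset.mul_sum, ← Finset.mul_sum, hμ]
    ring
  have hout : r ^ 2 * ∑ x ∈ A.filter (fun x => ¬ |(wt x : ℝ) - μ| ≤ r), z ^ wt x
      ≤ ∑ x ∈ A, ((wt x : ℝ) - μ) ^ 2 * z ^ wt x := by
    rw [Finset.mul_sum]
    refine (Finset.sum_le_sum fun x hx => ?_).trans
      (Finset.sum_le_sum_of_subset_of_nonneg (Finset.filter_subset _ A) fun x _ _ => by positivity)
    have hx' := not_le.mp (Finset.mem_filter.mp hx).2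
    refine mul_le_mul_of_nonneg_right ?_ (by positivity)
    rw [← sq_abs ((wt x : ℝ) - μ)]
    exact pow_le_pow_left₀ hr.le hx'.le 2
  have hsplit := Finset.sum_filter_add_sum_filter_not A (fun x => |(wt x : ℝ) - μ| ≤ r)
    fun x => z ^ wt x
  rw [← hWdef] at hsplit
  have hfin : ∑ x ∈ A.filter (fun x => ¬ |(wt x : ℝ) - μ| ≤ r), z ^ wt x ≤ W / 2 := by
    refine le_of_mul_le_mul_left ?_ (by positivity : 0 < r ^ 2)
    nlinarith [mul_le_mul_of_nonneg_right hvr hW.le]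
  linarith

/-- Large-deviation lower bound for the number of elements of weight at most `μ + r`. -/
lemma exists_eval_le_card_mul_rpow (A : Finset α) (wt : α → ℕ) {v r μ : ℝ} (hμ : 0 < μ)
    (hr : 0 < r) (hvr : 2 * v ≤ r ^ 2)
    (hM : ∀ z ∈ Set.Icc (0 : ℝ) 1, MomentBound z v (∑ x ∈ A, (X : Polynomial ℝ) ^ wt x)) :
    ∃ z ∈ Set.Ioc (0 : ℝ) 1, (μ ≤ v * z ∨ z = 1) ∧
      (∑ x ∈ A, (X : Polynomial ℝ) ^ wt x).eval z
        ≤ 2 * (A.filter fun x => (wt x : ℝ) ≤ μ + r).card * z ^ (μ - r) := by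
  set W : Polynomial ℝ := ∑ x ∈ A, (X : Polynomial ℝ) ^ wt x with hW
  set G : ℝ → ℝ := fun z => (eulerOp W).eval z - μ * W.eval z with hG
  have hGc : Continuous G := by
    exact ((eulerOp W).continuous).sub (continuous_const.mul W.continuous)
  have hG0 : G 0 < 0 := by
    have := (hM 0 ⟨le_rfl, zero_le_one⟩).1
    have h0 : G 0 = -(μ * W.eval 0) := by simp [hG, eulerOp]
    rw [h0]
    have := mul_pos hμ this
    linarith
  rcases le_or_gt (G 1) 0 with hG1 | hG1
  · refine ⟨1, ⟨one_pos, le_rfl⟩, Or.inr rfl, ?_⟩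
    have hM1 := hM 1 ⟨zero_le_one, le_rfl⟩
    have hW1 : 0 < W.eval 1 := hM1.1
    have hμ1 : (eulerOp W).eval 1 = (eulerOp W).eval 1 / W.eval 1 * ∑ x ∈ A, (1 : ℝ) ^ wt x := by
      rw [← eval_sum_X_pow, ← hW]
      field_simp
    have hle : (eulerOp W).eval 1 / W.eval 1 ≤ μ := by
      rw [div_le_iff₀ hW1]
      simp only [hG] at hG1
      linarith
    have hch := half_eval_le_sum_filter A wt zero_le_one hr hvr hM1 hμ1
    rw [← eval_sum_X_pow, ← hW] at hch
    simp only [one_pow, Finset.sum_const, nsmul_eq_mul, mul_one] at hch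
    have hsub : (A.filter fun x => |(wt x : ℝ) - (eulerOp W).eval 1 / W.eval 1| ≤ r).card
        ≤ (A.filter fun x => (wt x : ℝ) ≤ μ + r).card := by
      refine Finset.card_le_card (Finset.monotone_filter_right A fun x _ hx => ?_)
      have := (abs_le.mp hx).2
      linarith
    have hsub' : ((A.filter fun x => |(wt x : ℝ) - (eulerOp W).eval 1 / W.eval 1| ≤ r).card : ℝ)
        ≤ (A.filter fun x => (wt x : ℝ) ≤ μ + r).card := by exact_mod_cast hsub
    rw [Real.one_rpow, mul_one]
    linarith
  · obtain ⟨z, hz, hGz⟩ := intermediate_value_Icc zero_le_one hGc.continuousOn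
      (⟨hG0.le, hG1.le⟩ : (0 : ℝ) ∈ Set.Icc (G 0) (G 1))
    have hz0 : 0 < z := by
      rcases hz.1.eq_or_lt with h | h
      · rw [← h] at hGz; linarith
      · exact h
    have hMz := hM z hz
    have hmean : (eulerOp W).eval z = μ * W.eval z := by
      simp only [hG] at hGz
      linarith
    refine ⟨z, ⟨hz0, hz.2⟩, Or.inl ?_, ?_⟩
    · refine le_of_mul_le_mul_right ?_ hMz.1
      rw [← hmean, eulerOp, eval_mul, eval_X]
      nlinarith [mul_le_mul_of_nonneg_left hMz.2.1 hz.1]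
    · have hch := half_eval_le_sum_filter A wt hz.1 hr hvr hMz
        (by rw [← eval_sum_X_pow]; exact hmean)
      rw [← eval_sum_X_pow, ← hW] at hch
      have hterm : ∑ x ∈ A.filter (fun x => |(wt x : ℝ) - μ| ≤ r), z ^ wt x
          ≤ (A.filter fun x => (wt x : ℝ) ≤ μ + r).card * z ^ (μ - r) := by
        calc ∑ x ∈ A.filter (fun x => |(wt x : ℝ) - μ| ≤ r), z ^ wt x
            ≤ ∑ x ∈ A.filter (fun x => |(wt x : ℝ) - μ| ≤ r), z ^ (μ - r) := by
              refine Finset.sum_le_sum fun x hx => ?_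
              rw [← Real.rpow_natCast]
              refine Real.rpow_le_rpow_of_exponent_ge hz0 hz.2 ?_
              linarith [(abs_le.mp (Finset.mem_filter.mp hx).2).1]
          _ ≤ ∑ x ∈ A.filter (fun x => (wt x : ℝ) ≤ μ + r), z ^ (μ - r) := by
              refine Finset.sum_le_sum_of_subset_of_nonneg
                (Finset.monotone_filter_right A fun x _ hx => ?_)
                fun x _ _ => Real.rpow_nonneg hz.1 _
              have := (abs_le.mp hx).2
              linarith
          _ = (A.filter fun x => (wt x : ℝ) ≤ μ + r).card * z ^ (μ - r) := by
              rw [Finset.sum_const, nsmul_eq_mul]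
      linarith

end Moments

lemma lambdaQ_term_eq {q s : ℕ} (hq : 2 ≤ q) (ω : ℝ) {z : ℝ} (hz : z ∈ Set.Ioc (0 : ℝ) 1) :
    -ω * Real.logb q z - 1 / s +
      (1 / s) * Real.logb q ((1 + ((q : ℝ) - 1) * z) ^ s + ((q : ℝ) - 1) * (1 - z) ^ s)
      = -ω * Real.logb q z + (1 / s) * Real.logb q ((cosetEnum q s ((q : ℝ) - 1)).eval z) := by
  have hq0 : (0 : ℝ) < q := by positivity
  have hq1 : (1 : ℝ) < q := by exact_mod_cast hq
  have hB := one_le_eval_cosetEnum (by omega : 1 ≤ q) s ⟨hz.1.le, hz.2⟩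
  have h1 : (1 + ((q : ℝ) - 1) * z) ^ s + ((q : ℝ) - 1) * (1 - z) ^ s
      = q * (cosetEnum q s ((q : ℝ) - 1)).eval z := by
    rw [eval_cosetEnum]
    field_simp
  rw [h1, Real.logb_mul hq0.ne' (by linarith), Real.logb_self_eq_one hq1]
  ring

lemma lambdaQ_term_nonneg {q : ℕ} (s : ℕ) (hq : 2 ≤ q) {ω : ℝ} (hω : 0 ≤ ω)
    (z : Set.Ioc (0 : ℝ) 1) :
    0 ≤ -ω * Real.logb q (z : ℝ) - 1 / s + (1 / s) *
      Real.logb q ((1 + ((q : ℝ) - 1) * (z : ℝ)) ^ s + ((q : ℝ) - 1) * (1 - (z : ℝ)) ^ s) := by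
  have hq1 : (1 : ℝ) < q := by exact_mod_cast hq
  rw [lambdaQ_term_eq hq ω z.2]
  have h1 : Real.logb q (z : ℝ) ≤ 0 := Real.logb_nonpos hq1 z.2.1.le z.2.2
  have h2 : 0 ≤ Real.logb q ((cosetEnum q s ((q : ℝ) - 1)).eval (z : ℝ)) :=
    Real.logb_nonneg hq1 (one_le_eval_cosetEnum (by omega) s ⟨z.2.1.le, z.2.2⟩)
  have h3 := mul_nonneg hω (neg_nonneg.mpr h1)
  have h4 : 0 ≤ (1 / (s : ℝ)) * Real.logb q ((cosetEnum q s ((q : ℝ) - 1)).eval (z : ℝ)) := by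
    positivity
  linarith

lemma lambdaQ_nonneg {q : ℕ} (s : ℕ) (hq : 2 ≤ q) {ω : ℝ} (hω : 0 ≤ ω) : 0 ≤ lambdaQ q ω s :=
  Real.iInf_nonneg fun z => lambdaQ_term_nonneg s hq hω z

lemma lambdaQ_le {q : ℕ} (s : ℕ) (hq : 2 ≤ q) {ω z : ℝ} (hω : 0 ≤ ω)
    (hz : z ∈ Set.Ioc (0 : ℝ) 1) :
    lambdaQ q ω s ≤ -ω * Real.logb q z +
      (1 / s) * Real.logb q ((cosetEnum q s ((q : ℝ) - 1)).eval z) := by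
  rw [← lambdaQ_term_eq hq ω hz]
  exact ciInf_le ⟨0, by rintro _ ⟨y, rfl⟩; exact lambdaQ_term_nonneg s hq hω y⟩
    (⟨z, hz⟩ : Set.Ioc (0 : ℝ) 1)

lemma R0_nonneg {q s : ℕ} (hq : 2 ≤ q) (hs : 1 ≤ s) {ω : ℝ} (hω : 0 ≤ ω) : 0 ≤ R0 q ω s := by
  have hq1 : (1 : ℝ) < q := by exact_mod_cast hq
  have hs0 : (s : ℝ) ≠ 0 := by positivity
  have h := lambdaQ_le s hq hω (⟨one_pos, le_rfl⟩ : (1 : ℝ) ∈ Set.Ioc (0 : ℝ) 1)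
  rw [← lambdaQ_term_eq hq ω ⟨one_pos, le_rfl⟩] at h
  simp only [Real.logb_one, mul_zero, zero_sub, mul_one, add_sub_cancel, sub_self,
    zero_pow (by omega : s ≠ 0), add_zero, Real.logb_pow, Real.logb_self_eq_one hq1] at h
  rw [R0]
  have : ((s : ℝ) - 1) / s = -(1 / s) + 1 / s * s := by field_simp; ring
  linarith

lemma R0_le_one {q : ℕ} (s : ℕ) (hq : 2 ≤ q) {ω : ℝ} (hω : 0 ≤ ω) : R0 q ω s ≤ 1 := by
  have h := lambdaQ_nonneg s hq hω
  have : ((s : ℝ) - 1) / s ≤ 1 := div_le_one_of_le₀ (by linarith) (by positivity)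
  rw [R0]
  linarith

lemma innerMin_le_one {q n : ℕ} (hq : 2 ≤ q) {ω : ℝ} (hω : 0 ≤ ω) {π : ℕ → ℝ}
    (hπ : ∀ s ∈ Finset.Icc 1 n, 0 ≤ π s) (hsum : ∑ s ∈ Finset.Icc 1 n, π s = 1) :
    innerMin q n ω π ≤ 1 := by
  refine le_trans (b := ∑ s ∈ Finset.Icc 1 n, π s * R0 q ω s)
    (csInf_le ⟨0, ?_⟩ ⟨fun _ => ω, fun _ _ => hω, ?_, rfl⟩) ?_
  · rintro _ ⟨ϑ, hϑ, -, rfl⟩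
    exact Finset.sum_nonneg fun s hs =>
      mul_nonneg (hπ s hs) (R0_nonneg hq (Finset.mem_Icc.mp hs).1 (hϑ s hs))
  · rw [← Finset.sum_mul, hsum, one_mul]
  · rw [← hsum]
    exact Finset.sum_le_sum fun s hs => mul_le_of_le_one_right (hπ s hs) (R0_le_one s hq hω)

lemma innerMin_le_Rbar0 {q n : ℕ} (hq : 2 ≤ q) {ω μ : ℝ} (hω : 0 ≤ ω) {π : ℕ → ℝ}
    (hπ : ∀ s ∈ Finset.Icc 1 n, 0 ≤ π s) (hsum : ∑ s ∈ Finset.Icc 1 n, π s = 1)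
    (hμ : 1 / μ ≤ ∑ s ∈ Finset.Icc 1 n, π s / (s : ℝ)) :
    innerMin q n ω π ≤ Rbar0 q n ω μ := by
  refine le_csSup ⟨1, ?_⟩ ⟨π, hπ, hsum, hμ, rfl⟩
  rintro _ ⟨ρ, hρ, hρ1, -, rfl⟩
  exact innerMin_le_one hq hω hρ hρ1

lemma Rbar0_le_one {q n : ℕ} (hq : 2 ≤ q) {ω μ : ℝ} (hω : 0 ≤ ω) : Rbar0 q n ω μ ≤ 1 := by
  refine Real.sSup_le ?_ zero_le_one
  rintro _ ⟨ρ, hρ, hρ1, -, rfl⟩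
  exact innerMin_le_one hq hω hρ hρ1

lemma le_Rhat0_of_mem {q n : ℕ} (hq : 2 ≤ q) {ω ν : ℝ} (hω : 0 ≤ ω)
    (hν : ν ∈ Set.Icc (0 : ℝ) (((n : ℝ) - 1) / ((n : ℝ) + 1))) :
    ν + (1 - ν) * Rbar0 q n (ω / (1 - ν)) (((1 - ν) / (1 + ν)) * n) ≤ Rhat0 q n ω := by
  refine le_csSup ⟨1, ?_⟩ ⟨ν, hν, rfl⟩
  rintro _ ⟨ξ, hξ, rfl⟩
  have h1 : ξ ≤ 1 := hξ.2.trans (div_le_one_of_le₀ (by linarith) (by positivity))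
  have h2 : Rbar0 q n (ω / (1 - ξ)) (((1 - ξ) / (1 + ξ)) * n) ≤ 1 :=
    Rbar0_le_one hq (div_nonneg hω (by linarith))
  nlinarith [mul_le_mul_of_nonneg_left h2 (by linarith : 0 ≤ 1 - ξ)]

/-- Lower bound for the minimum over `ϑ` obtained by evaluating every `λ_q` at a common `z`. -/
lemma le_innerMin {q n : ℕ} (hq : 2 ≤ q) {ω z : ℝ} (hω : 0 ≤ ω) (hz : z ∈ Set.Ioc (0 : ℝ) 1)
    {π : ℕ → ℝ} (hπ : ∀ s ∈ Finset.Icc 1 n, 0 ≤ π s)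
    (hsum : ∑ s ∈ Finset.Icc 1 n, π s = 1) :
    1 - ∑ s ∈ Finset.Icc 1 n, π s / s + ω * Real.logb q z -
      ∑ s ∈ Finset.Icc 1 n, π s / s * Real.logb q ((cosetEnum q s ((q : ℝ) - 1)).eval z)
      ≤ innerMin q n ω π := by
  refine le_csInf ⟨_, fun _ => ω, fun _ _ => hω, ?_, rfl⟩ ?_
  · rw [← Finset.sum_mul, hsum, one_mul]
  · rintro _ ⟨ϑ, hϑ, hϑω, rfl⟩
    have hexp : ∑ s ∈ Finset.Icc 1 n, (π s - π s / s + π s * ϑ s * Real.logb q z -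
          π s / s * Real.logb q ((cosetEnum q s ((q : ℝ) - 1)).eval z))
        = 1 - ∑ s ∈ Finset.Icc 1 n, π s / s + ω * Real.logb q z -
          ∑ s ∈ Finset.Icc 1 n,
            π s / s * Real.logb q ((cosetEnum q s ((q : ℝ) - 1)).eval z) := by
      rw [Finset.sum_sub_distrib, Finset.sum_add_distrib, Finset.sum_sub_distrib, hsum,
        ← Finset.sum_mul, hϑω]
    rw [← hexp]
    refine Finset.sum_le_sum fun s hs => ?_
    have hs0 : (s : ℝ) ≠ 0 := by
      have := (Finset.mem_Icc.mp hs).1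
      positivity
    have h := mul_le_mul_of_nonneg_left (lambdaQ_le s hq (hϑ s hs) hz) (hπ s hs)
    have h1 : π s * (((s : ℝ) - 1) / s) = π s - π s / s := by field_simp
    rw [R0, mul_sub, h1]
    linarith [(by ring : π s * (-ϑ s * Real.logb q z +
      1 / s * Real.logb q ((cosetEnum q s ((q : ℝ) - 1)).eval z)) = -(π s * ϑ s * Real.logb q z) +
      π s / s * Real.logb q ((cosetEnum q s ((q : ℝ) - 1)).eval z))]

lemma le_Rhat0 {q n N D : ℕ} (hq : 2 ≤ q) (hn : 1 ≤ n) (hN : 0 < N) (k : ℕ → ℕ)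
    (hsum : ∑ s ∈ Finset.Icc 1 n, k s * s + D = N)
    (hcov : N + D ≤ n * ∑ s ∈ Finset.Icc 1 n, k s)
    {ω z : ℝ} (hω : 0 ≤ ω) (hz : z ∈ Set.Ioc (0 : ℝ) 1) :
    1 - ((∑ s ∈ Finset.Icc 1 n, k s : ℕ) : ℝ) / N + ω * Real.logb q z -
      (∑ s ∈ Finset.Icc 1 n, k s * Real.logb q ((cosetEnum q s ((q : ℝ) - 1)).eval z)) / N
      ≤ Rhat0 q n ω := by
  have hmU : ∑ s ∈ Finset.Icc 1 n, k s ≤ ∑ s ∈ Finset.Icc 1 n, k s * s :=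
    Finset.sum_le_sum fun s hs => Nat.le_mul_of_pos_right _ (Finset.mem_Icc.mp hs).1
  set m : ℕ := ∑ s ∈ Finset.Icc 1 n, k s with hm
  set U : ℕ := ∑ s ∈ Finset.Icc 1 n, k s * s with hU
  have hUpos : 0 < U := by
    rcases Nat.eq_zero_or_pos U with h | h
    · have : m = 0 := by omega
      simp [this] at hcov
      omega
    · exact h
  have hN' : (0 : ℝ) < N := by exact_mod_cast hN
  have hU' : (0 : ℝ) < U := by exact_mod_cast hUpos
  have hn' : (0 : ℝ) < n := by exact_mod_cast hn
  have hsumR : (U : ℝ) + D = N := by exact_mod_cast hsum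
  have hcovR : (N : ℝ) + D ≤ n * m := by exact_mod_cast hcov
  have hmUR : (m : ℝ) ≤ U := by exact_mod_cast hmU
  have hD : (0 : ℝ) ≤ D := Nat.cast_nonneg D
  set ν : ℝ := D / N with hν
  have h1ν : 1 - ν = U / N := by rw [hν]; field_simp; linarith
  have h2ν : 1 + ν = (N + D) / N := by rw [hν]; field_simp
  have hνmem : ν ∈ Set.Icc (0 : ℝ) (((n : ℝ) - 1) / ((n : ℝ) + 1)) := by
    refine ⟨by positivity, ?_⟩
    rw [hν, div_le_div_iff₀ hN' (by positivity)]
    nlinarith [mul_le_mul_of_nonneg_left hmUR hn'.le]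
  set π : ℕ → ℝ := fun s => k s * s / U with hπ
  have hπ0 : ∀ s ∈ Finset.Icc 1 n, 0 ≤ π s := fun s _ => by positivity
  have hπ1 : ∑ s ∈ Finset.Icc 1 n, π s = 1 := by
    rw [hπ, ← Finset.sum_div, div_eq_one_iff_eq hU'.ne', hU]
    push_cast
    rfl
  have hπs : ∀ s ∈ Finset.Icc 1 n, π s / (s : ℝ) = k s / U := by
    intro s hs
    have hs0 : (s : ℝ) ≠ 0 := by
      have := (Finset.mem_Icc.mp hs).1
      positivity
    simp only [hπ]
    field_simp
  have hπm : ∑ s ∈ Finset.Icc 1 n, π s / (s : ℝ) = m / U := by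
    rw [Finset.sum_congr rfl hπs, ← Finset.sum_div, hm]
    push_cast
    rfl
  have hμ : 1 / (((1 - ν) / (1 + ν)) * n) ≤ ∑ s ∈ Finset.Icc 1 n, π s / (s : ℝ) := by
    have : 1 / (((1 - ν) / (1 + ν)) * n) = (N + D) / (n * U) := by
      rw [h1ν, h2ν]
      field_simp
    rw [hπm, this, div_le_div_iff₀ (by positivity) hU']
    nlinarith [mul_le_mul_of_nonneg_right hcovR hU'.le]
  have hω' : 0 ≤ ω / (1 - ν) := by rw [h1ν]; positivity
  have h1 := (le_innerMin hq hω' hz hπ0 hπ1).trans (innerMin_le_Rbar0 hq hω' hπ0 hπ1 hμ)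
  have h2 := le_Rhat0_of_mem hq hω hνmem
  refine le_trans ?_ h2
  refine le_trans (le_of_eq ?_)
    (add_le_add_right (mul_le_mul_of_nonneg_left h1 (by rw [h1ν]; positivity)) ν)
  have hL : ∑ s ∈ Finset.Icc 1 n,
      π s / s * Real.logb q ((cosetEnum q s ((q : ℝ) - 1)).eval z)
      = (∑ s ∈ Finset.Icc 1 n, k s * Real.logb q ((cosetEnum q s ((q : ℝ) - 1)).eval z)) / U := by
    rw [Finset.sum_div]
    refine Finset.sum_congr rfl fun s hs => ?_
    rw [hπs s hs]
    ring
  rw [hπm, hL, h1ν, hν, ← hsumR]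
  have : (U : ℝ) + D ≠ 0 := by linarith
  field_simp
  ring

lemma logb_prod_cosetEnum {q : ℕ} (hq : 1 ≤ q) (n : ℕ) (k : ℕ → ℕ) {z : ℝ}
    (hz : z ∈ Set.Icc (0 : ℝ) 1) :
    Real.logb q ((∏ s ∈ Finset.Icc 1 n, cosetEnum q s ((q : ℝ) - 1) ^ k s).eval z)
      = ∑ s ∈ Finset.Icc 1 n, k s * Real.logb q ((cosetEnum q s ((q : ℝ) - 1)).eval z) := by
  rw [Polynomial.eval_prod, Real.logb_prod]
  · simp [Real.logb_pow]
  · intro s _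
    rw [Polynomial.eval_pow]
    exact pow_ne_zero _ (by linarith [one_le_eval_cosetEnum hq s hz])

lemma logb_add_le_of_mul_pow_le {q M V m N : ℕ} (hq : 2 ≤ q) (hM : 0 < M) (hV : 0 < V)
    (h : M * V * q ^ m ≤ q ^ N) :
    Real.logb q M + Real.logb q V + m ≤ N := by
  have hq1 : (1 : ℝ) < q := by exact_mod_cast hq
  have hM' : (0 : ℝ) < M := by exact_mod_cast hM
  have hV' : (0 : ℝ) < V := by exact_mod_cast hV
  have h' : (M : ℝ) * V * (q : ℝ) ^ m ≤ (q : ℝ) ^ N := by exact_mod_cast h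
  have := Real.logb_le_logb_of_le hq1 (by positivity) h'
  rwa [Real.logb_mul (by positivity) (by positivity), Real.logb_mul hM'.ne' hV'.ne',
    Real.logb_pow, Real.logb_pow, Real.logb_self_eq_one hq1, mul_one, mul_one] at this

section SingleCode

variable {K : Type} [Field K] [Fintype K] [DecidableEq K] {N n : ℕ}

/-- Finite-length sphere-packing bound for positive relative distance. -/
lemma rate_le_of_lt_minDist (hn : 1 ≤ n) (hN : 0 < N) {c : ℝ} (hc1 : 1 ≤ c)
    (hc : ∀ s ∈ Finset.Icc 1 n, ∀ z ∈ Set.Icc (0 : ℝ) 1,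
      MomentBound z c (cosetEnum (Fintype.card K) s ((Fintype.card K : ℝ) - 1)))
    (C : Set (Fin N → K)) (hne : C.Nonempty) (hC : ∃ Rg, IsLinRecLRC C n Rg)
    {δ η : ℝ} (hδ : 0 < δ) (hδ1 : δ ≤ 1) (hη : 0 < η) (hηδ : η ≤ δ / 4)
    (hNη : 8 * c ≤ η ^ 2 * N) (hd : (δ - η) * N < minDist C) :
    Real.logb (Fintype.card K) C.ncard / N ≤ Rhat0 (Fintype.card K) n (δ / 2) +
      3 / 2 * η * -Real.logb (Fintype.card K) (δ / (4 * c)) + 1 / N := by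
  obtain ⟨k, D, A, hsum, hcov, hW, h0A, hcount⟩ := exists_disjoint_groups C hC
  have hq : 2 ≤ Fintype.card K := Fintype.one_lt_card
  set q := Fintype.card K with hqdef
  have hq1 : (1 : ℝ) < q := by exact_mod_cast hq
  have hN' : (0 : ℝ) < N := by exact_mod_cast hN
  have hmN : ∑ s ∈ Finset.Icc 1 n, k s ≤ N := by
    have : ∑ s ∈ Finset.Icc 1 n, k s ≤ ∑ s ∈ Finset.Icc 1 n, k s * s :=
      Finset.sum_le_sum fun s hs => Nat.le_mul_of_pos_right _ (Finset.mem_Icc.mp hs).1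
    omega
  have hM : ∀ z ∈ Set.Icc (0 : ℝ) 1, MomentBound z (((∑ s ∈ Finset.Icc 1 n, k s : ℕ) : ℝ) * c)
      (∑ x ∈ A, (Polynomial.X : Polynomial ℝ) ^ hammingNorm x) := by
    intro z hz
    rw [hW]
    have := MomentBound.prod (Finset.Icc 1 n) (fun s => (k s : ℝ) * c) _
      fun s hs => (hc s hs z hz).pow (k s)
    rwa [← Finset.sum_mul, ← Nat.cast_sum] at this
  have hmc : ((∑ s ∈ Finset.Icc 1 n, k s : ℕ) : ℝ) * c ≤ N * c :=
    mul_le_mul_of_nonneg_right (by exact_mod_cast hmN) (by linarith)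
  obtain ⟨z, hz, hzlow, hvol⟩ := exists_eval_le_card_mul_rpow A (fun x => hammingNorm x)
    (r := η * N / 2) (μ := (δ / 2 - η) * N) (mul_pos (by linarith) hN') (by positivity)
    (by nlinarith [mul_le_mul_of_nonneg_right hNη hN'.le]) hM
  have hB := le_Rhat0 hq hn hN k hsum hcov (by positivity : 0 ≤ δ / 2) hz
  rw [← logb_prod_cosetEnum (by omega) n k ⟨hz.1.le, hz.2⟩, ← hW] at hB
  set m := ∑ s ∈ Finset.Icc 1 n, k s
  set V := A.filter fun x => x = 0 ∨ 2 * hammingNorm x < minDist C with hV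
  have hVpos : 0 < V.card := Finset.card_pos.mpr ⟨0, by simp [hV, h0A]⟩
  have hCpos : 0 < C.ncard := (Set.ncard_pos).mpr hne
  have hcount' := logb_add_le_of_mul_pow_le hq hCpos hVpos hcount
  have hsub : (A.filter fun x => (hammingNorm x : ℝ) ≤ (δ / 2 - η) * N + η * N / 2).card
      ≤ V.card := by
    refine Finset.card_le_card (Finset.monotone_filter_right A fun x _ hx => Or.inr ?_)
    have : (2 * hammingNorm x : ℝ) < minDist C := by linarith
    exact_mod_cast this
  set e : ℝ := (δ / 2 - η) * N - η * N / 2 with he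
  have hVR : (0 : ℝ) < V.card := by exact_mod_cast hVpos
  have hvol' : (∑ x ∈ A, (Polynomial.X : Polynomial ℝ) ^ hammingNorm x).eval z
      ≤ 2 * V.card * z ^ e := by
    refine hvol.trans (mul_le_mul_of_nonneg_right ?_ (Real.rpow_nonneg hz.1.le _))
    exact mul_le_mul_of_nonneg_left (by exact_mod_cast hsub) zero_le_two
  have hlogW := Real.logb_le_logb_of_le hq1 (hM z ⟨hz.1.le, hz.2⟩).1 hvol'
  have hze : 0 < z ^ e := Real.rpow_pos_of_pos hz.1 e
  rw [Real.logb_mul (by positivity) hze.ne', Real.logb_mul two_ne_zero hVR.ne',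
    Real.logb_rpow_eq_mul_logb_of_pos hz.1] at hlogW
  have hlog2 : Real.logb q 2 ≤ 1 := by
    rw [Real.logb_le_iff_le_rpow hq1 two_pos, Real.rpow_one]
    exact_mod_cast hq
  have hz0 : δ / (4 * c) ≤ z := by
    rw [div_le_iff₀ (by positivity)]
    rcases hzlow with h | h
    · have h1 : (δ / 2 - η) * N ≤ z * c * N := by
        linarith [mul_le_mul_of_nonneg_right hmc hz.1.le]
      have h2 : δ / 2 - η ≤ z * c := le_of_mul_le_mul_right h1 hN'
      linarith
    · rw [h]; linarith
  have hlogz : Real.logb q (δ / (4 * c)) ≤ Real.logb q z :=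
    Real.logb_le_logb_of_le hq1 (by positivity) hz0
  have hmain : Real.logb q C.ncard ≤ N - m + (1 + e * Real.logb q z) -
      Real.logb q ((∑ x ∈ A, (Polynomial.X : Polynomial ℝ) ^ hammingNorm x).eval z) := by
    linarith
  have hB' := mul_le_mul_of_nonneg_right hB hN'.le
  have hexp : (1 - (m : ℝ) / N + δ / 2 * Real.logb q z -
      Real.logb q ((∑ x ∈ A, (Polynomial.X : Polynomial ℝ) ^ hammingNorm x).eval z) / N) * N
      = N - m + δ / 2 * Real.logb q z * N -
      Real.logb q ((∑ x ∈ A, (Polynomial.X : Polynomial ℝ) ^ hammingNorm x).eval z) := by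
    field_simp
  rw [hexp] at hB'
  have hlast : 3 / 2 * η * N * Real.logb q (δ / (4 * c)) ≤ 3 / 2 * η * N * Real.logb q z :=
    mul_le_mul_of_nonneg_left hlogz (by positivity)
  rw [div_le_iff₀ hN', add_mul, add_mul, one_div_mul_cancel hN'.ne']
  rw [he] at hmain
  linarith

/-- Finite-length bound at relative distance zero. -/
lemma rate_le_Rhat0_zero_add (hn : 1 ≤ n) (hN : 0 < N) {c z : ℝ} (hc1 : 1 ≤ c)
    (hz : z ∈ Set.Ioc (0 : ℝ) 1)
    (hc : ∀ s ∈ Finset.Icc 1 n,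
      (cosetEnum (Fintype.card K) s ((Fintype.card K : ℝ) - 1)).eval z ≤ 1 + c * z)
    (C : Set (Fin N → K)) (hne : C.Nonempty) (hC : ∃ Rg, IsLinRecLRC C n Rg) :
    Real.logb (Fintype.card K) C.ncard / N ≤ Rhat0 (Fintype.card K) n 0 +
      Real.logb (Fintype.card K) (1 + c * z) := by
  obtain ⟨k, D, A, hsum, hcov, -, h0A, hcount⟩ := exists_disjoint_groups C hC
  have hq : 2 ≤ Fintype.card K := Fintype.one_lt_card
  set q := Fintype.card K with hqdef
  have hq1 : (1 : ℝ) < q := by exact_mod_cast hq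
  have hN' : (0 : ℝ) < N := by exact_mod_cast hN
  have hmN : ∑ s ∈ Finset.Icc 1 n, k s ≤ N := by
    have : ∑ s ∈ Finset.Icc 1 n, k s ≤ ∑ s ∈ Finset.Icc 1 n, k s * s :=
      Finset.sum_le_sum fun s hs => Nat.le_mul_of_pos_right _ (Finset.mem_Icc.mp hs).1
    omega
  have hB := le_Rhat0 hq hn hN k hsum hcov le_rfl hz
  have hlog0 : 0 ≤ Real.logb q (1 + c * z) :=
    Real.logb_nonneg hq1 (by nlinarith [hz.1])
  have hlogW : ∑ s ∈ Finset.Icc 1 n, k s * Real.logb q ((cosetEnum q s ((q : ℝ) - 1)).eval z)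
      ≤ N * Real.logb q (1 + c * z) := by
    calc ∑ s ∈ Finset.Icc 1 n, k s * Real.logb q ((cosetEnum q s ((q : ℝ) - 1)).eval z)
        ≤ ∑ s ∈ Finset.Icc 1 n, k s * Real.logb q (1 + c * z) := by
          refine Finset.sum_le_sum fun s hs => mul_le_mul_of_nonneg_left ?_ (Nat.cast_nonneg _)
          refine Real.logb_le_logb_of_le hq1 ?_ (hc s hs)
          linarith [one_le_eval_cosetEnum (by omega : 1 ≤ q) s ⟨hz.1.le, hz.2⟩]
      _ ≤ N * Real.logb q (1 + c * z) := by
          rw [← Finset.sum_mul, ← Nat.cast_sum]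
          exact mul_le_mul_of_nonneg_right (by exact_mod_cast hmN) hlog0
  set V := A.filter fun x => x = 0 ∨ 2 * hammingNorm x < minDist C with hV
  have hVpos : 0 < V.card := Finset.card_pos.mpr ⟨0, by simp [hV, h0A]⟩
  have hCpos : 0 < C.ncard := (Set.ncard_pos).mpr hne
  have hcount' := logb_add_le_of_mul_pow_le hq hCpos hVpos hcount
  have hVlog : 0 ≤ Real.logb q V.card :=
    Real.logb_nonneg hq1 (by exact_mod_cast hVpos)
  have h1 : Real.logb q C.ncard / N ≤ 1 - ((∑ s ∈ Finset.Icc 1 n, k s : ℕ) : ℝ) / N := by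
    rw [div_le_iff₀ hN', sub_mul, div_mul_cancel₀ _ hN'.ne']
    linarith
  have h2 : (∑ s ∈ Finset.Icc 1 n, k s * Real.logb q ((cosetEnum q s ((q : ℝ) - 1)).eval z)) / N
      ≤ Real.logb q (1 + c * z) := by
    rw [div_le_iff₀ hN', mul_comm]
    exact hlogW
  linarith

end SingleCode

/-- Sphere-packing bound, general (not necessarily all-disjoint) case: the rate of every
linearly recoverable `(δ,n)`-LRC sequence over `F` is bounded from above by
`R̂_SP(δ,n) = R̂_0(δ/2,n)`. -/
theorem spherePacking_nondisjoint
    (K : Type) [Field K] [Fintype K] [DecidableEq K]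
    (q : ℕ) (hq : Fintype.card K = q)
    (n : ℕ) (hn : 2 ≤ n)
    (δ : ℝ) (hδ : δ ∈ Set.Ico (0:ℝ) (((q:ℝ) - 1) / q))
    -- the given linearly recoverable `(δ,n)`-LRC sequence
    (N : ℕ → ℕ) (C : ∀ i : ℕ, Set (Fin (N i) → K))
    (hmono : StrictMono N) (hne : ∀ i, (C i).Nonempty)
    (hLRC : ∀ i, ∃ Rg : Fin (N i) → Finset (Fin (N i)), IsLinRecLRC (C i) n Rg)
    (hdist : δ ≤ liminf (fun i => (minDist (C i) : ℝ) / (N i : ℝ)) atTop) :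
    limsup (fun i => Real.logb q ((C i).ncard : ℝ) / (N i : ℝ)) atTop
      ≤ Rhat0 q n (δ / 2) := by
  subst hq
  set q := Fintype.card K with hqdef
  have hq : 2 ≤ q := Fintype.one_lt_card
  have hq1 : (1 : ℝ) < q := by exact_mod_cast hq
  obtain ⟨c, hc1, hc⟩ := exists_momentBound_cosetEnum (by omega : 1 ≤ q) n
  have hNtop : Tendsto (fun i => (N i : ℝ)) atTop atTop :=
    tendsto_natCast_atTop_atTop.comp hmono.tendsto_atTop
  have hcob : IsCoboundedUnder (· ≤ ·) atTop
      fun i => Real.logb q ((C i).ncard : ℝ) / (N i : ℝ) := by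
    refine isCoboundedUnder_le_of_le atTop (x := 0) fun i => ?_
    have h1 : 0 < (C i).ncard := (Set.ncard_pos).mpr (hne i)
    exact div_nonneg (Real.logb_nonneg hq1 (by exact_mod_cast h1)) (Nat.cast_nonneg _)
  refine le_of_forall_pos_le_add fun ε hε => limsup_le_of_le hcob ?_
  rcases hδ.1.eq_or_lt with hδ0 | hδ0
  · have hqε : 1 < (q : ℝ) ^ ε := Real.one_lt_rpow hq1 hε
    set z : ℝ := min 1 (((q : ℝ) ^ ε - 1) / c) with hzdef
    have hz : z ∈ Set.Ioc (0 : ℝ) 1 :=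
      ⟨lt_min one_pos (div_pos (by linarith) (by linarith)), min_le_left _ _⟩
    have hlog : Real.logb q (1 + c * z) ≤ ε := by
      have hcz : 0 < 1 + c * z := by nlinarith [hz.1]
      rw [Real.logb_le_iff_le_rpow hq1 hcz]
      have h1 : z ≤ ((q : ℝ) ^ ε - 1) / c := min_le_right _ _
      rw [le_div_iff₀ (by linarith)] at h1
      linarith
    filter_upwards [hNtop.eventually_gt_atTop 0] with i hi
    have := rate_le_Rhat0_zero_add (by omega : 1 ≤ n) (by exact_mod_cast hi) hc1 hz
      (fun s hs => (hc s hs z ⟨hz.1.le, hz.2⟩).2) (C i) (hne i) (hLRC i)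
    rw [← hδ0, zero_div]
    linarith
  · have hδ1 : δ ≤ 1 :=
      hδ.2.le.trans (div_le_one_of_le₀ (by linarith) (by linarith))
    set L : ℝ := -Real.logb q (δ / (4 * c)) with hL
    have hL0 : 0 ≤ L := by
      rw [hL, neg_nonneg]
      refine Real.logb_nonpos hq1 (by positivity) ?_
      rw [div_le_one (by positivity)]
      linarith
    set η : ℝ := min (δ / 4) (ε / (3 * (L + 1))) with hηdef
    have hη : 0 < η := lt_min (by linarith) (by positivity)
    have hηL : 3 / 2 * η * L ≤ ε / 2 := by
      have h1 : η ≤ ε / (3 * (L + 1)) := min_le_right _ _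
      rw [le_div_iff₀ (by positivity)] at h1
      nlinarith
    have hbdd : IsBoundedUnder (· ≥ ·) atTop
        fun i => (minDist (C i) : ℝ) / (N i : ℝ) :=
      isBoundedUnder_of ⟨0, fun i => by positivity⟩
    have hev := eventually_lt_of_lt_liminf (lt_of_lt_of_le (by linarith : δ - η < δ) hdist) hbdd
    filter_upwards [hNtop.eventually_gt_atTop 0, hev,
      hNtop.eventually_ge_atTop (8 * c / η ^ 2), hNtop.eventually_ge_atTop (2 / ε)]
      with i hi hdi hNη hNε
    rw [lt_div_iff₀ hi] at hdi
    rw [div_le_iff₀ (by positivity), mul_comm _ (η ^ 2)] at hNη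
    have := rate_le_of_lt_minDist (by omega : 1 ≤ n) (by exact_mod_cast hi) hc1
      (fun s hs z hz => (hc s hs z hz).1) (C i) (hne i) (hLRC i) hδ0 hδ1 hη
      (min_le_left _ _) hNη hdi
    have hNε' : 1 / (N i : ℝ) ≤ ε / 2 := by
      rw [div_le_iff₀ hε] at hNε
      rw [div_le_iff₀ hi]
      linarith
    linarith
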